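/- Any nonerasing morphism f : A* → B* that preserves the LSP property for infinite words belongs to S_{R-bLSP}(B)* U(A,B) ∪ P_LSP(A,B): either f factors as a composition of finitely many R-bLSP morphisms with an element of U(A,B), or f belongs to P_LSP(A,B). -/

import Mathlib

section LSPDefs

variable {A : Type*} {B : Type*}

/-- `u` is a prefix of the infinite word `w`. -/
def IsPrefixI (u : List A) (w : ℕ → A) : Prop :=
  ∀ (i : ℕ) (h : i < u.length), u.get ⟨i, h⟩ = w i

/-- `u` is a factor of the infinite word `w`. -/
def IsFactorI (u : List A) (w : ℕ → A) : Prop :=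
  ∃ k : ℕ, ∀ (i : ℕ) (h : i < u.length), u.get ⟨i, h⟩ = w (k + i)

/-- `u` is a left special factor of the infinite word `w`. -/
def LeftSpecialI (u : List A) (w : ℕ → A) : Prop :=
  ∃ a b : A, a ≠ b ∧ IsFactorI (a :: u) w ∧ IsFactorI (b :: u) w

/-- An infinite word is LSP if all its left special factors are prefixes of it. -/
def IsLSP (w : ℕ → A) : Prop :=
  ∀ u : List A, LeftSpecialI u w → IsPrefixI u w

/-- Application of a morphism (given by images of letters) to a finite word. -/
def applyM (f : A → List B) (u : List A) : List B := (u.map f).flatten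

/-- The prefix of length `n` of an infinite word. -/
def infPrefix (w : ℕ → A) (n : ℕ) : List A := List.ofFn (fun i : Fin n => w i)

/-- `x` is the image of the infinite word `w` under the morphism `f`. -/
def InfImage (f : A → List B) (w : ℕ → A) (x : ℕ → B) : Prop :=
  ∀ n : ℕ, IsPrefixI (applyM f (infPrefix w n)) x

/-- `f` is a basic LSP (bLSP) endomorphism. -/
def IsBLSP (f : A → List A) : Prop :=
  ∃ α : A, f α = [α] ∧ ∀ β : A, β ≠ α → ∃ γ : A, f β = f γ ++ [β]

/-- `f` is an R-bLSP morphism with domain alphabet `D`: the restriction to `D` of a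
bLSP morphism `g` (letters outside the domain are sent to `[]`). -/
def IsRBLSPOn (D : Set A) (f : A → List A) : Prop :=
  (∀ x : A, x ∈ D ↔ f x ≠ []) ∧ ∃ g : A → List A, IsBLSP g ∧ ∀ x ∈ D, f x = g x

/-- The episturmian morphism `L_α`. -/
def Lmor [DecidableEq A] (α : A) : A → List A := fun β => if β = α then [α] else [α, β]

/-- `u` is an `(a,b,c,β,γ)`-fragility of `w`. -/
def Frag5 (w : ℕ → A) (a b c β γ : A) (u : List A) : Prop :=
  IsPrefixI (u ++ [a]) w ∧ IsFactorI (β :: (u ++ [b])) w ∧ IsFactorI (γ :: (u ++ [c])) w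

/-- `w` is `(a,b,c)`-fragile. -/
def Fragile (w : ℕ → A) (a b c : A) : Prop :=
  ∃ (u : List A) (β γ : A), β ≠ γ ∧ Frag5 w a b c β γ u

/-- `f` is LSP `(a,b,c)`-breaking (for words over the domain `D` of `f`). -/
def Breaking (D : Set A) (f : A → List A) (a b c : A) : Prop :=
  ∀ (w x : ℕ → A), Set.range w ⊆ D → IsLSP w → Fragile w a b c →
    InfImage f w x → ¬ IsLSP x

/-- Length of the longest common prefix of two finite words. -/
noncomputable def lcpLen (u v : List A) : ℕ :=
  sSup {n | n ≤ u.length ∧ n ≤ v.length ∧ u.take n = v.take n}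

/-- A morphism is nonerasing if images of letters are nonempty. -/
def Nonerasing (f : A → List B) : Prop := ∀ a : A, f a ≠ []

/-- `f` preserves the LSP property for infinite words. -/
def PreservesLSP (f : A → List B) : Prop :=
  ∀ (w : ℕ → A) (x : ℕ → B), IsLSP w → InfImage f w x → IsLSP x

/-- `f ∈ U(A,B)`: nonerasing and each letter of `B` occurs at most once in total
among the images of letters. -/
def InU [Fintype A] [DecidableEq B] (f : A → List B) : Prop :=
  Nonerasing f ∧ ∀ b : B, (∑ a : A, (f a).count b) ≤ 1

/-- `u^k`. -/
def listPow (u : List B) (k : ℕ) : List B := (List.replicate k u).flatten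

/-- `x = u^ω`. -/
def IsOmegaPow (u : List B) (x : ℕ → B) : Prop := ∀ k : ℕ, IsPrefixI (listPow u k) x

/-- `f ∈ P_LSP(A,B)`: nonerasing, all images are positive powers of a word `u`
with `u^ω` LSP. -/
def InPLSP (f : A → List B) : Prop :=
  Nonerasing f ∧ ∃ u : List B, u ≠ [] ∧ (∀ a : A, ∃ k : ℕ, 0 < k ∧ f a = listPow u k) ∧
    ∀ x : ℕ → B, IsOmegaPow u x → IsLSP x

/-- `r` is the primitive root of `w`. -/
def IsPrimRoot (r w : List B) : Prop :=
  (∃ k : ℕ, 0 < k ∧ w = listPow r k) ∧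
  ∀ (v : List B) (k : ℕ), 0 < k → w = listPow v k → r.length ≤ v.length

/-- Compatibility of a chain of morphisms `[g_1, …, g_n]` (composition
`g_1 ∘ ⋯ ∘ g_n`): every letter produced by `g_{i+1}` lies in the domain of `g_i`. -/
def CompatChain (L : List (B → List B)) : Prop :=
  List.Chain' (fun g h => ∀ x y, y ∈ h x → g y ≠ []) L

end LSPDefs

section LSPProof
variable {A : Type*} {B : Type*}

/-- the periodic word -/
def om (u : List B) (h : u ≠ []) : ℕ → B := fun i =>
  u[i % u.length]'(Nat.mod_lt _ (List.length_pos_iff.2 h))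

theorem om_get (u : List B) (h : u ≠ []) (i : ℕ) : u[i % u.length]? = some (om u h i) := by
  simp [om]

theorem om_lt (u : List B) (h : u ≠ []) (i : ℕ) (hi : i < u.length) :
    u[i]? = some (om u h i) := by
  have := om_get u h i
  rwa [Nat.mod_eq_of_lt hi] at this

theorem om_add (u : List B) (h : u ≠ []) (i : ℕ) : om u h (i + u.length) = om u h i := by
  simp [om]

theorem om_add_mul (u : List B) (h : u ≠ []) (i t : ℕ) :
    om u h (i + t * u.length) = om u h i := by
  simp [om]

theorem om_ext (u : List B) (h : u ≠ []) (x : ℕ → B) (h1 : ∀ i, i < u.length → u[i]? = some (x i))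
    (h2 : ∀ i, x (i + u.length) = x i) : om u h = x := by
  have h3 : ∀ t i, x (i + t * u.length) = x i := by
    intro t
    induction t with
    | zero => simp
    | succ t ih => intro i; rw [Nat.succ_mul, ← add_assoc, h2, ih]
  funext i
  have h4 := om_get u h i
  rw [h1 _ (Nat.mod_lt _ (List.length_pos_iff.2 h))] at h4
  have := h3 (i / u.length) (i % u.length)
  rw [Nat.mod_add_div'] at this
  rw [this]
  exact (Option.some.inj h4).symm

theorem om_rot (X Y : List B) (h : X ++ Y ≠ []) (h' : Y ++ X ≠ []) (i : ℕ) :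
    om (Y ++ X) h' i = om (X ++ Y) h (i + X.length) := by
  have : om (Y ++ X) h' = fun i => om (X ++ Y) h (i + X.length) := by
    apply om_ext
    · intro i hi
      simp only [List.length_append] at hi
      by_cases hY : i < Y.length
      · have := om_lt (X ++ Y) h (i + X.length) (by simp; omega)
        rw [← this, List.getElem?_append_left hY, List.getElem?_append_right (by omega)]
        simp
      · push Not at hY
        have := om_lt (X ++ Y) h (i - Y.length) (by simp; omega)
        have h2 := om_add (X ++ Y) h (i - Y.length)
        simp only [List.length_append] at h2
        rw [show i - Y.length + (X.length + Y.length) = i + X.length by omega] at h2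
        rw [h2, ← this, List.getElem?_append_right hY, List.getElem?_append_left (by omega)]
    · intro i
      have := om_add (X ++ Y) h (i + X.length)
      simp only [List.length_append] at this ⊢
      rw [← this]; congr 1; omega
  rw [this]

theorem lsp_idx {w : ℕ → B} (hw : IsLSP w) {k k' n : ℕ} (hne : w k ≠ w k')
    (he : ∀ i, i < n → w (k + 1 + i) = w (k' + 1 + i)) (i : ℕ) (hi : i < n) :
    w (k + 1 + i) = w i := by
  have := hw (List.ofFn (fun i : Fin n => w (k + 1 + i))) ⟨_, _, hne, ⟨k, ?_⟩, ⟨k', ?_⟩⟩ i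
    (by simpa using hi)
  · simpa using this
  · intro m hm
    cases m with
    | zero => simp
    | succ m => simp; congr 1; omega
  · intro m hm
    cases m with
    | zero => simp
    | succ m =>
      simp only [List.length_cons, List.length_ofFn] at hm
      have := he m (by omega)
      simp [this]; congr 1; omega

theorem det (X Y : List B) (h : X ++ Y ≠ []) (h' : Y ++ X ≠ [])
    (l1 : IsLSP (om (X ++ Y) h)) (l2 : IsLSP (om (Y ++ X) h'))
    (hd : om (X ++ Y) h 0 ≠ om (X ++ Y) h X.length) (i j : ℕ)
    (hij : om (X ++ Y) h (i + 1) = om (X ++ Y) h (j + 1)) :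
    om (X ++ Y) h i = om (X ++ Y) h j := by
  by_contra hne
  have key : ∀ k, om (Y ++ X) h' (k + Y.length) = om (X ++ Y) h k := by
    intro k
    rw [om_rot X Y h h', add_assoc, add_comm Y.length, ← List.length_append, om_add]
  have e1 := lsp_idx l1 hne (n := 1) (by intro k hk; obtain rfl : k = 0 := (by omega); simpa using hij)
    0 (by omega)
  have e2 := lsp_idx l2 (k := i + Y.length) (k' := j + Y.length) (n := 1) (by rwa [key, key])
    (by
      intro k hk; obtain rfl : k = 0 := (by omega)
      rw [add_zero, add_zero, add_right_comm, add_right_comm j, key, key, hij]) 0 (by omega)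
  rw [om_rot X Y h h' 0, add_zero, add_right_comm, key] at e2
  simp only [add_zero, zero_add] at e1 e2
  exact hd (e1.symm.trans e2)

/-- deterministic periodic words: equal letters yield a period -/
theorem det_period (u : List B) (h : u ≠ [])
    (hdet : ∀ i j, om u h (i + 1) = om u h (j + 1) → om u h i = om u h j)
    (i p : ℕ) (hi : om u h (i + p) = om u h i) (k : ℕ) : om u h (k + p) = om u h k := by
  have down : ∀ m i, om u h (i + m + p) = om u h (i + m) → om u h (i + p) = om u h i := by
    intro m
    induction m with
    | zero => intro i hi; simpa using hi
    | succ m ih =>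
      intro i hi
      apply ih
      apply hdet
      rw [show i + m + p + 1 = i + (m + 1) + p by omega]; exact hi
  have hpos := List.length_pos_iff.2 h
  have hle : k ≤ i + k * u.length := by nlinarith
  obtain ⟨m, hm⟩ := Nat.exists_eq_add_of_le hle
  apply down m
  rw [← hm, om_add_mul, add_right_comm, om_add_mul, hi]

theorem noperiod (X Y : List B) (hX : X ≠ []) (hY : Y ≠ []) (h : X ++ Y ≠ [])
    (h3 : X ++ X ++ Y ≠ []) (l3 : IsLSP (om (X ++ X ++ Y) h3))
    (hdet : ∀ i j, om (X ++ Y) h (i + 1) = om (X ++ Y) h (j + 1) →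
      om (X ++ Y) h i = om (X ++ Y) h j)
    (hd : om (X ++ Y) h 0 ≠ om (X ++ Y) h X.length) (p : ℕ) (hp : 0 < p) (hpY : p ≤ Y.length)
    (hper : ∀ k, om (X ++ Y) h (k + p) = om (X ++ Y) h k) : False := by
  have hXp := List.length_pos_iff.2 hX
  have hYp := List.length_pos_iff.2 hY
  have hlast : om (X ++ Y) h (X.length - 1) ≠ om (X ++ Y) h (X.length + Y.length - 1) := by
    intro e
    have := det_period _ h hdet (X.length - 1) Y.length
      (by rw [e]; congr 1; omega) X.length
    rw [← this, ← List.length_append] at hd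
    apply hd
    simpa using (om_add _ h 0).symm
  have hx1 : ∀ i, i < X.length → om (X ++ X ++ Y) h3 i = om (X ++ Y) h i := by
    intro i hi
    have a1 := om_lt _ h3 i (by simp; omega)
    have a2 := om_lt _ h i (by simp; omega)
    rw [List.getElem?_append_left (by simp; omega), List.getElem?_append_left hi] at a1
    rw [List.getElem?_append_left hi] at a2
    rw [a1] at a2
    exact Option.some.inj a2
  have hx : ∀ i, i < X.length + Y.length + X.length →
      om (X ++ X ++ Y) h3 (X.length + i) = om (X ++ Y) h i := by
    intro i hi
    by_cases hi2 : i < X.length + Y.length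
    · have a1 := om_lt _ h3 (X.length + i) (by simp; omega)
      have a2 := om_lt _ h i (by simp; omega)
      have a3 : (X ++ X ++ Y)[X.length + i]? = (X ++ Y)[i]? := by
        rw [List.append_assoc, List.getElem?_append_right (by omega), Nat.add_sub_cancel_left]
      rw [← a3, a1] at a2
      exact Option.some.inj a2
    · have b1 := om_add _ h3 (i - (X.length + Y.length))
      have b2 := om_add _ h (i - (X.length + Y.length))
      rw [hx1 (i - (X.length + Y.length)) (by omega), ← b2] at b1
      simp only [List.length_append] at b1
      convert b1 using 2 <;> omega
  have h1 : om (X ++ X ++ Y) h3 (X.length - 1) = om (X ++ Y) h (X.length - 1) :=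
    hx1 _ (by omega)
  have h2 : om (X ++ X ++ Y) h3 (X.length + p - 1) = om (X ++ Y) h (X.length + Y.length - 1) := by
    rw [show X.length + p - 1 = X.length + (p - 1) by omega, hx (p - 1) (by omega)]
    rw [← hper (X.length + Y.length - 1), show X.length + Y.length - 1 + p =
      p - 1 + (X ++ Y).length by simp; omega, om_add]
  have := lsp_idx l3 (k := X.length - 1) (k' := X.length + p - 1) (n := X.length + 1)
    (by rw [h1, h2]; exact hlast) (by
      intro i hi
      rw [show X.length - 1 + 1 + i = X.length + i by omega,
        show X.length + p - 1 + 1 + i = X.length + (i + p) by omega,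
        hx i (by omega), hx (i + p) (by omega), hper]) X.length (by omega)
  rw [show X.length - 1 + 1 + X.length = X.length + X.length by omega, hx X.length (by omega)] at this
  have h0 := hx 0 (by omega)
  rw [add_zero] at h0
  rw [h0] at this
  exact hd this.symm

theorem twoNodup (X Y : List B) (hX : X ≠ []) (hY : Y ≠ []) (h : X ++ Y ≠ []) (h' : Y ++ X ≠ [])
    (h3 : X ++ X ++ Y ≠ []) (h3' : Y ++ Y ++ X ≠ [])
    (l1 : IsLSP (om (X ++ Y) h)) (l2 : IsLSP (om (Y ++ X) h'))
    (l3 : IsLSP (om (X ++ X ++ Y) h3)) (l3' : IsLSP (om (Y ++ Y ++ X) h3'))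
    (hd : om (X ++ Y) h 0 ≠ om (X ++ Y) h X.length) : (X ++ Y).Nodup := by
  have hdet := det X Y h h' l1 l2 hd
  have hd' : om (Y ++ X) h' 0 ≠ om (Y ++ X) h' Y.length := by
    rw [om_rot X Y h h', om_rot X Y h h']
    intro e
    rw [add_comm Y.length, ← List.length_append, zero_add] at e
    apply hd
    rw [e]
    simpa using (om_add _ h 0).symm
  have hdet' := det Y X h' h l2 l1 hd'
  have main : ∀ p, 0 < p → 2 * p ≤ X.length + Y.length →
      (∀ k, om (X ++ Y) h (k + p) = om (X ++ Y) h k) → False := by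
    intro p hp hp2 hper
    by_cases hc : p ≤ Y.length
    · exact noperiod X Y hX hY h h3 l3 hdet hd p hp hc hper
    · refine noperiod Y X hY hX h' h3' l3' hdet' hd' p hp (by omega) ?_
      intro k
      rw [om_rot X Y h h', om_rot X Y h h', add_right_comm, hper]
  rw [List.nodup_iff_injective_get]
  by_contra hinj
  have : ∃ i j, i < j ∧ j < X.length + Y.length ∧ om (X ++ Y) h i = om (X ++ Y) h j := by
    simp only [Function.Injective] at hinj
    push Not at hinj
    obtain ⟨a, b, hab, hne⟩ := hinj
    have e : ∀ a : Fin (X ++ Y).length, (X ++ Y).get a = om (X ++ Y) h a := by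
      intro a
      have := om_lt _ h a a.2
      rw [List.getElem?_eq_getElem a.2] at this
      exact Option.some.inj this
    rw [e, e] at hab
    have ha := a.2
    have hb := b.2
    have hlen := List.length_append (as := X) (bs := Y)
    have ha' := lt_of_lt_of_eq ha hlen
    have hb' := lt_of_lt_of_eq hb hlen
    rcases lt_or_gt_of_ne (fun h => hne (Fin.ext h) : (a : ℕ) ≠ b) with hl | hl
    · exact ⟨a, b, hl, hb', hab⟩
    · exact ⟨b, a, hl, ha', hab.symm⟩
  obtain ⟨i, j, hij, hj, e⟩ := this
  have hper := det_period _ h hdet i (j - i) (by rw [e]; congr 1; omega)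
  by_cases hc : 2 * (j - i) ≤ X.length + Y.length
  · exact main _ (by omega) hc hper
  · refine main (X.length + Y.length - (j - i)) (by omega) (by omega) ?_
    intro k
    rw [← hper, show k + (X.length + Y.length - (j - i)) + (j - i) = k + (X ++ Y).length by
      simp; omega, om_add]

theorem three (X Y Z : List B) (hX : X ≠ []) (hY : Y ≠ []) (hZ : Z ≠ [])
    (h : X ++ (Y ++ Z) ≠ []) (h' : (Y ++ Z) ++ X ≠ [])
    (l1 : IsLSP (om (X ++ (Y ++ Z)) h)) (l2 : IsLSP (om ((Y ++ Z) ++ X) h'))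
    (hd : X.head? ≠ Y.head?) (he : X.head? = Z.head?) (hn : (Z ++ Y).Nodup) : False := by
  have hXp := List.length_pos_iff.2 hX
  have hYp := List.length_pos_iff.2 hY
  have hZp := List.length_pos_iff.2 hZ
  have x0 := om_lt _ h 0 (by simp; omega)
  have x1 := om_lt _ h X.length (by simp; omega)
  have x2 := om_lt _ h (X.length + Y.length) (by simp; omega)
  have x3 := om_lt _ h (X.length + Y.length - 1) (by simp; omega)
  have x4 := om_lt _ h (X.length + Y.length + Z.length - 1) (by simp; omega)
  rw [List.getElem?_append_left (by omega), ← List.head?_eq_getElem?] at x0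
  rw [List.getElem?_append_right (by omega), List.getElem?_append_left (by omega)] at x1
  rw [List.getElem?_append_right (by omega), List.getElem?_append_right (by omega)] at x2
  rw [List.getElem?_append_right (by omega), List.getElem?_append_left (by omega)] at x3
  rw [List.getElem?_append_right (by omega), List.getElem?_append_right (by omega)] at x4
  simp only [Nat.add_sub_cancel_left, Nat.sub_self] at x1 x2
  rw [← List.head?_eq_getElem?] at x1 x2
  have := det X (Y ++ Z) h h' l1 l2
    (by intro e; apply hd; rw [x0, x1, e]) (X.length + Y.length - 1)
      (X.length + Y.length + Z.length - 1) (by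
        rw [show X.length + Y.length + Z.length - 1 + 1 = 0 + (X ++ (Y ++ Z)).length by
          simp; omega, om_add, show X.length + Y.length - 1 + 1 = X.length + Y.length by omega]
        rw [he, x2] at x0
        exact Option.some.inj x0)
  rw [this] at x3
  have m1 := List.mem_of_getElem? x3
  have m2 := List.mem_of_getElem? x4
  rw [List.nodup_append] at hn
  exact hn.2.2 _ m2 _ m1 rfl

/-! test words -/
theorem om_nodup_LSP (l : List A) (h : l ≠ []) (hn : l.Nodup) : IsLSP (om l h) := by
  rintro u ⟨a, b, hab, ⟨k, hk⟩, ⟨k', hk'⟩⟩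
  cases u with
  | nil => intro i hi; simp at hi
  | cons c t =>
    exfalso
    apply hab
    have a0 := hk 0 (by simp)
    have a1 := hk 1 (by simp)
    have b0 := hk' 0 (by simp)
    have b1 := hk' 1 (by simp)
    simp at a0 a1 b0 b1
    rw [a1] at b1
    rw [a0, b0]
    simp only [om] at b1 ⊢
    rw [hn.getElem_inj_iff] at b1
    have : k % l.length = k' % l.length := Nat.ModEq.add_right_cancel' 1 b1
    simp [this]

theorem om_aab_LSP (a b : A) (h : [a, a, b] ≠ []) (hab : a ≠ b) : IsLSP (om [a,a,b] h) := by
  have v : ∀ k, om [a,a,b] h k = if k % 3 = 2 then b else a := by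
    intro k
    have h1 : k % 3 = 0 ∨ k % 3 = 1 ∨ k % 3 = 2 := by omega
    rcases h1 with h1 | h1 | h1 <;> simp [om, h1]
  rintro u ⟨c, d, hcd, ⟨k, hk⟩, ⟨k', hk'⟩⟩
  simp only [v] at hk hk'
  intro i hi
  rw [v]
  have a0 := hk 0 (by simp)
  have b0 := hk' 0 (by simp)
  simp at a0 b0
  match u, hi with
  | [e], hi =>
    have a1 := hk 1 (by simp)
    have b1 := hk' 1 (by simp)
    simp at a1 b1 hi
    subst hi
    simp
    split_ifs at a0 a1 b0 b1 <;> first | exact a1 | exact b1 | (exfalso; omega) | (exfalso; simp_all)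
  | e :: e' :: t, hi =>
    exfalso
    have a1 := hk 1 (by simp)
    have b1 := hk' 1 (by simp)
    have a2 := hk 2 (by simp)
    have b2 := hk' 2 (by simp)
    simp at a1 b1 a2 b2
    split_ifs at a0 a1 b0 b1 a2 b2 <;> first | omega | (simp_all)

end LSPProof

section LSPProof2
variable {A : Type*} {B : Type*}

theorem applyM_append (f : A → List B) (u v : List A) :
    applyM f (u ++ v) = applyM f u ++ applyM f v := by simp [applyM]
theorem applyM_nil (f : A → List B) : applyM f [] = [] := by simp [applyM]
theorem applyM_single (f : A → List B) (a : A) : applyM f [a] = f a := by simp [applyM]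
theorem applyM_cons (f : A → List B) (a : A) (u : List A) :
    applyM f (a :: u) = f a ++ applyM f u := by simp [applyM]

theorem applyM_comp {C : Type*} (f : A → List B) (g : B → List C) (u : List A) :
    applyM (fun a => applyM g (f a)) u = applyM g (applyM f u) := by
  induction u with
  | nil => simp [applyM_nil]
  | cons a u ih => rw [applyM_cons, applyM_cons, applyM_append, ih]

theorem applyM_listPow (f : A → List B) (u : List A) (n : ℕ) :
    applyM f (listPow u n) = listPow (applyM f u) n := by
  induction n with
  | zero => simp [listPow, applyM]
  | succ n ih =>
    simp only [listPow, List.replicate_succ, List.flatten_cons] at ih ⊢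
    rw [applyM_append, ih]

theorem applyM_prefix (f : A → List B) {u v : List A} (h : u <+: v) :
    applyM f u <+: applyM f v := by
  obtain ⟨t, rfl⟩ := h
  rw [applyM_append]; exact List.prefix_append _ _

theorem length_applyM (f : A → List B) (hf : Nonerasing f) (u : List A) :
    u.length ≤ (applyM f u).length := by
  induction u with
  | nil => simp
  | cons a u ih =>
    have := List.length_pos_iff.2 (hf a)
    rw [applyM_cons]; simp; omega

theorem applyM_ne_nil (f : A → List B) (hf : Nonerasing f) (u : List A) (hu : u ≠ []) :
    applyM f u ≠ [] := by
  have h1 := length_applyM f hf u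
  have h2 := List.length_pos_iff.2 hu
  exact List.length_pos_iff.1 (by omega)

theorem infPrefix_length (w : ℕ → A) (n : ℕ) : (infPrefix w n).length = n := by simp [infPrefix]

theorem infPrefix_get? (w : ℕ → A) (n i : ℕ) (hi : i < n) : (infPrefix w n)[i]? = some (w i) := by
  simp [infPrefix, hi]

theorem infPrefix_add (w : ℕ → A) (m k : ℕ) :
    infPrefix w (m + k) = infPrefix w m ++ infPrefix (fun i => w (m + i)) k := by
  apply List.ext_getElem?
  intro i
  by_cases h : i < m
  · rw [List.getElem?_append_left (by rwa [infPrefix_length]), infPrefix_get? _ _ _ h,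
      infPrefix_get? _ _ _ (by omega)]
  · rw [List.getElem?_append_right (by rw [infPrefix_length]; omega), infPrefix_length]
    by_cases h2 : i < m + k
    · rw [infPrefix_get? _ _ _ h2, infPrefix_get? _ _ _ (by omega)]
      congr 2; omega
    · rw [List.getElem?_eq_none (by rw [infPrefix_length]; omega),
        List.getElem?_eq_none (by rw [infPrefix_length]; omega)]

theorem infPrefix_mono (w : ℕ → A) {m n : ℕ} (h : m ≤ n) : infPrefix w m <+: infPrefix w n := by
  obtain ⟨k, rfl⟩ := Nat.exists_eq_add_of_le h
  rw [infPrefix_add]; exact List.prefix_append _ _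

theorem isPrefixI_iff (u : List A) (w : ℕ → A) : IsPrefixI u w ↔ u = infPrefix w u.length := by
  constructor
  · intro h
    apply List.ext_getElem
    · rw [infPrefix_length]
    · intro i h1 h2
      have := h i h1
      simpa [infPrefix] using this
  · intro h i hi
    have h1 := infPrefix_get? w u.length i hi
    rw [← h, List.getElem?_eq_getElem hi] at h1
    exact Option.some.inj h1

theorem isPrefixI_infPrefix (w : ℕ → A) (n : ℕ) : IsPrefixI (infPrefix w n) w := by
  rw [isPrefixI_iff, infPrefix_length]

theorem isPrefixI_of_prefix {u v : List A} {w : ℕ → A} (h : u <+: v) (hv : IsPrefixI v w) :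
    IsPrefixI u w := by
  obtain ⟨t, rfl⟩ := h
  intro i hi
  have := hv i (by simp; omega)
  rw [← this]
  simp [List.getElem_append_left hi]

theorem infPrefix_om (u : List A) (h : u ≠ []) (n : ℕ) :
    infPrefix (om u h) (n * u.length) = listPow u n := by
  have h1 : infPrefix (om u h) u.length = u := by
    symm
    rw [← isPrefixI_iff]
    intro i hi
    have := om_lt u h i hi
    rw [List.getElem?_eq_getElem hi] at this
    exact Option.some.inj this
  induction n with
  | zero => simp [infPrefix, listPow]
  | succ n ih =>
    rw [Nat.succ_mul, add_comm, infPrefix_add, h1]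
    have : (fun i => om u h (u.length + i)) = om u h := by
      funext i; rw [add_comm, om_add]
    rw [this, ih]
    simp [listPow, List.replicate_succ]

theorem omImage (f : A → List B) (u : List A) (h : u ≠ [])
    (h' : applyM f u ≠ []) : InfImage f (om u h) (om (applyM f u) h') := by
  intro n
  have hp := List.length_pos_iff.2 h
  refine isPrefixI_of_prefix (applyM_prefix f (infPrefix_mono _
    (show n ≤ n * u.length by nlinarith))) ?_
  rw [infPrefix_om, applyM_listPow, ← infPrefix_om _ h']
  exact isPrefixI_infPrefix _ _

theorem pres_om (f : A → List B) (hp : PreservesLSP f) (l : List A) (h : l ≠ [])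
    (hl : IsLSP (om l h)) (X : List B) (hX : X ≠ []) (e : applyM f l = X) : IsLSP (om X hX) := by
  subst e
  exact hp _ _ hl (omImage f l h hX)

theorem pair_nodup (f : A → List B) (hf : Nonerasing f) (hp : PreservesLSP f) (a b : A)
    (hd : (f a).head? ≠ (f b).head?) : (f a ++ f b).Nodup := by
  have hab : a ≠ b := by rintro rfl; exact hd rfl
  have ha := hf a
  have hb := hf b
  have hap := List.length_pos_iff.2 ha
  have hbp := List.length_pos_iff.2 hb
  refine twoNodup (f a) (f b) ha hb (by simp [ha]) (by simp [hb]) (by simp [ha]) (by simp [hb])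
    ?_ ?_ ?_ ?_ ?_
  · exact pres_om f hp [a, b] (by simp) (om_nodup_LSP _ _ (by simp [hab])) _ _ (by simp [applyM])
  · exact pres_om f hp [b, a] (by simp) (om_nodup_LSP _ _ (by simp [hab.symm])) _ _
      (by simp [applyM])
  · exact pres_om f hp [a, a, b] (by simp) (om_aab_LSP _ _ _ hab) _ _ (by simp [applyM])
  · exact pres_om f hp [b, b, a] (by simp) (om_aab_LSP _ _ _ hab.symm) _ _ (by simp [applyM])
  · intro e
    apply hd
    have h : f a ++ f b ≠ [] := by simp [ha]
    have x0 := om_lt _ h 0 (by simp; omega)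
    have x1 := om_lt _ h (f a).length (by simp; omega)
    rw [List.getElem?_append_left (by omega), ← List.head?_eq_getElem?] at x0
    rw [List.getElem?_append_right (by omega), Nat.sub_self, ← List.head?_eq_getElem?] at x1
    rw [x0, x1, e]

theorem heads_inj (f : A → List B) (hf : Nonerasing f) (hp : PreservesLSP f) (a b c : A)
    (hd : (f a).head? ≠ (f b).head?) (he : (f a).head? = (f c).head?) : a = c := by
  by_contra hac
  have hab : a ≠ b := by rintro rfl; exact hd rfl
  have hcb : c ≠ b := by rintro rfl; exact hd he
  refine three (f a) (f b) (f c) (hf a) (hf b) (hf c) (by simp [hf a]) (by simp [hf b]) ?_ ?_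
    hd he (pair_nodup f hf hp c b (by rwa [← he]))
  · exact pres_om f hp [a, b, c] (by simp) (om_nodup_LSP _ _ (by simp [hab, hac, hcb.symm])) _ _
      (by simp [applyM])
  · exact pres_om f hp [b, c, a] (by simp)
      (om_nodup_LSP _ _ (by simp [hab.symm, Ne.symm hac, hcb.symm])) _ _ (by simp [applyM])

theorem inU_of_heads [Fintype A] [DecidableEq B] (f : A → List B) (hf : Nonerasing f)
    (hp : PreservesLSP f) (a b : A) (hd : (f a).head? ≠ (f b).head?) : InU f := by
  classical
  refine ⟨hf, ?_⟩
  have hinj : ∀ c d, c ≠ d → (f c).head? ≠ (f d).head? := by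
    intro c d hcd he
    by_cases h : (f c).head? = (f a).head?
    · exact hcd (heads_inj f hf hp c b d (by rwa [h]) he)
    · exact hcd (heads_inj f hf hp c a d h he)
  have hnd : ∀ c, (f c).Nodup := by
    intro c
    by_cases h : c = a
    · subst h; exact (List.nodup_append.1 (pair_nodup f hf hp _ _ hd)).1
    · exact (List.nodup_append.1 (pair_nodup f hf hp _ _ (hinj c a h))).1
  intro y
  by_cases hy : ∃ c, y ∈ f c
  · obtain ⟨c, hc⟩ := hy
    rw [Finset.sum_eq_single c]
    · exact List.nodup_iff_count_le_one.1 (hnd c) y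
    · intro d _ hdc
      apply List.count_eq_zero_of_not_mem
      intro hy
      exact (List.nodup_append.1 (pair_nodup f hf hp _ _ (hinj d c hdc))).2.2 _ hy _ hc rfl
    · simp
  · push Not at hy
    rw [Finset.sum_eq_zero]
    · omega
    · intro c _; exact List.count_eq_zero_of_not_mem (hy c)

/-! bLSP morphisms -/

theorem exists_image (g : A → List B) (hg : Nonerasing g) (w : ℕ → A) :
    ∃ x : ℕ → B, InfImage g w x := by
  have hl : ∀ n, n ≤ (applyM g (infPrefix w n)).length := by
    intro n
    have := length_applyM g hg (infPrefix w n)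
    rwa [infPrefix_length] at this
  refine ⟨fun i => (applyM g (infPrefix w (i+1)))[i]'(by have := hl (i+1); omega), ?_⟩
  intro n i hi
  have key : ∀ m k : ℕ, m ≤ k → ∀ (h1 : i < (applyM g (infPrefix w m)).length)
      (h2 : i < (applyM g (infPrefix w k)).length),
      (applyM g (infPrefix w m))[i] = (applyM g (infPrefix w k))[i] := by
    intro m k hmk h1 h2
    exact (applyM_prefix g (infPrefix_mono w hmk)).getElem h1
  have h2 : i < (applyM g (infPrefix w (i+1))).length := by have := hl (i+1); omega
  rcases le_total n (i+1) with h | h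
  · exact key _ _ h hi h2
  · exact (key _ _ h h2 hi).symm

/-- the properties of bLSP morphisms that are used -/
theorem blsp_props (g : B → List B) (α : B) (h0 : g α = [α])
    (h1 : ∀ β : B, β ≠ α → ∃ γ : B, g β = g γ ++ [β]) (β : B) :
    ∃ s, g β = α :: s ∧ α ∉ s ∧ (∃ t, g β = t ++ [β]) ∧ (β ≠ α → s ≠ []) := by
  generalize hn : (g β).length = n
  induction n using Nat.strong_induction_on generalizing β with
  | _ n ih =>
    by_cases hb : β = α
    · subst hb
      exact ⟨[], h0, by simp, ⟨[], by simpa using h0⟩, by simp⟩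
    · obtain ⟨γ, hγ⟩ := h1 β hb
      obtain ⟨s, hs, hs2, -, -⟩ := ih (g γ).length (by rw [← hn, hγ]; simp) γ rfl
      refine ⟨s ++ [β], ?_, ?_, ⟨g γ, hγ⟩, by simp⟩
      · rw [hγ, hs]; simp
      · simp [hs2, Ne.symm hb]

theorem blsp_recog (g : B → List B) (α : B)
    (hg : ∀ β, ∃ s, g β = α :: s ∧ α ∉ s ∧ (∃ t, g β = t ++ [β]) ∧ (β ≠ α → s ≠ []))
    (u v : List B) (huv : u.length = v.length) (s t : List B)
    (h : applyM g u ++ α :: s = applyM g v ++ α :: t) : u = v := by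
  induction u generalizing v with
  | nil => exact (List.length_eq_zero_iff.1 huv.symm).symm
  | cons b u ih =>
    cases v with
    | nil => simp at huv
    | cons c v =>
      rw [applyM_cons, applyM_cons, List.append_assoc, List.append_assoc] at h
      have start : ∀ (u s : List B), ∃ r, applyM g u ++ α :: s = α :: r := by
        intro u s
        cases u with
        | nil => exact ⟨s, by simp [applyM_nil]⟩
        | cons b u =>
          obtain ⟨q, hq, -⟩ := hg b
          exact ⟨_, by rw [applyM_cons, hq]; simp; rfl⟩
      obtain ⟨q1, e1, n1, ⟨t1, l1⟩, -⟩ := hg b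
      obtain ⟨q2, e2, n2, ⟨t2, l2⟩, -⟩ := hg c
      obtain ⟨r1, hr1⟩ := start u s
      obtain ⟨r2, hr2⟩ := start v t
      have hh := h
      rw [hr1, hr2, e1, e2, List.cons_append, List.cons_append] at hh
      have hq : q1 = q2 := by
        have hh := (List.cons.inj hh).2
        rcases List.append_eq_append_iff.1 hh with ⟨d, hd1, hd2⟩ | ⟨d, hd1, hd2⟩
        · cases d with
          | nil => simpa using hd1.symm
          | cons z d =>
            simp only [List.cons_append, List.cons.injEq] at hd2
            exfalso; apply n2; rw [hd1, ← hd2.1]; simp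
        · cases d with
          | nil => simpa using hd1
          | cons z d =>
            simp only [List.cons_append, List.cons.injEq] at hd2
            exfalso; apply n1; rw [hd1, ← hd2.1]; simp
      have hbc : g b = g c := by rw [e1, e2, hq]
      have : b = c := by
        rw [l1, l2] at hbc
        have := congrArg List.getLast? hbc
        simpa using this
      subst this
      rw [ih v (by simpa using huv) (List.append_cancel_left h)]

theorem blsp_reflect (g : B → List B) (α : B)
    (hg : ∀ β, ∃ s, g β = α :: s ∧ α ∉ s ∧ (∃ t, g β = t ++ [β]) ∧ (β ≠ α → s ≠ []))
    (w x : ℕ → B) (hi : InfImage g w x) (hx : IsLSP x) : IsLSP w := by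
  have fac : ∀ b u, IsFactorI (b :: u) w → IsFactorI (b :: (applyM g u ++ [α])) x := by
    rintro b u ⟨k, hk⟩
    have e : infPrefix w (k + (u.length + 1) + 1) =
        infPrefix w k ++ (b :: u) ++ [w (k + (u.length + 1))] := by
      rw [infPrefix_add, infPrefix_add]
      congr 1
      · congr 1
        symm
        exact (isPrefixI_iff (b :: u) (fun i => w (k + i))).1 hk
    have h1 := hi (k + (u.length + 1) + 1)
    obtain ⟨t, -, -, ⟨q, hq⟩, -⟩ := hg b
    obtain ⟨t', hq', -⟩ := hg (w (k + (u.length + 1)))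
    rw [e, applyM_append, applyM_append, applyM_cons, applyM_single, hq, hq'] at h1
    have h2 : IsPrefixI ((applyM g (infPrefix w k) ++ q) ++ (b :: (applyM g u ++ [α]))) x := by
      refine isPrefixI_of_prefix ⟨t', ?_⟩ h1
      simp
    refine ⟨(applyM g (infPrefix w k) ++ q).length, ?_⟩
    intro i hi
    have h3 := h2 ((applyM g (infPrefix w k) ++ q).length + i)
      (by rw [List.length_append (bs := b :: _)]; omega)
    rw [← h3, List.get_eq_getElem, List.get_eq_getElem, List.getElem_append_right (by simp)]
    simp only [Nat.add_sub_cancel_left]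
  rintro u ⟨a, b, hab, ha, hb⟩
  have h1 := hx (applyM g u ++ [α]) ⟨a, b, hab, fac _ _ ha, fac _ _ hb⟩
  have h2 := hi (u.length + 1)
  obtain ⟨t', hq', -⟩ := hg (w u.length)
  have e : infPrefix w (u.length + 1) = infPrefix w u.length ++ [w u.length] := by
    rw [infPrefix_add]; simp [infPrefix]
  rw [e, applyM_append, applyM_single, hq'] at h2
  rw [isPrefixI_iff] at h1 h2 ⊢
  have hc : (applyM g u ++ [α]) <+: (applyM g (infPrefix w u.length) ++ α :: t') ∨
      (applyM g (infPrefix w u.length) ++ α :: t') <+: (applyM g u ++ [α]) := by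
    rw [h1, h2]
    rcases le_total (applyM g u ++ [α]).length (applyM g (infPrefix w u.length) ++ α :: t').length
      with h | h
    · left; exact infPrefix_mono x h
    · right; exact infPrefix_mono x h
  rcases hc with ⟨r, hr⟩ | ⟨r, hr⟩
  · exact blsp_recog g α hg u _ (infPrefix_length _ _).symm r t' (by simpa using hr)
  · exact (blsp_recog g α hg _ u (infPrefix_length _ _) (t' ++ r) [] (by simpa using hr)).symm

/-- block ending at position `i` -/
noncomputable def blk (x : ℕ → B) : ℕ → List B
  | 0 => [x 0]
  | i + 1 => by classical exact if x (i + 1) = x 0 then [x 0] else blk x i ++ [x (i + 1)]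

theorem blk_alpha (x : ℕ → B) (i : ℕ) (h : x i = x 0) : blk x i = [x 0] := by
  cases i with
  | zero => rfl
  | succ i => simp [blk, h]

theorem blk_succ (x : ℕ → B) (i : ℕ) (h : x (i + 1) ≠ x 0) :
    blk x (i + 1) = blk x i ++ [x (i + 1)] := by simp [blk, h]

theorem blk_congr (x : ℕ → B) (hx : IsLSP x) (i j : ℕ) (h : x i = x j) : blk x i = blk x j := by
  induction i generalizing j with
  | zero => rw [blk_alpha x 0 rfl, blk_alpha x j h.symm]
  | succ i ih =>
    by_cases hi : x (i + 1) = x 0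
    · rw [blk_alpha x _ hi, blk_alpha x j (h ▸ hi)]
    · cases j with
      | zero => exact absurd h hi
      | succ j =>
        have : x i = x j := by
          by_contra hne
          apply hi
          exact lsp_idx hx hne (n := 1) (by
            intro k hk; obtain rfl : k = 0 := (by omega); simpa using h) 0 (by omega)
        rw [blk_succ x i hi, blk_succ x j (h ▸ hi), ih j this, h]

open Classical in
/-- the bLSP morphism associated with an LSP word -/
noncomputable def gmor (x : ℕ → B) (β : B) : List B :=
  if h : ∃ i, x i = β then blk x h.choose else [x 0, β]

theorem gmor_eq (x : ℕ → B) (hx : IsLSP x) (i : ℕ) : gmor x (x i) = blk x i := by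
  have h : ∃ j, x j = x i := ⟨i, rfl⟩
  rw [gmor, dif_pos h]
  exact blk_congr x hx _ _ h.choose_spec

theorem gmor_alpha (x : ℕ → B) (hx : IsLSP x) : gmor x (x 0) = [x 0] := by
  rw [gmor_eq x hx]; rfl

theorem gmor_blsp (x : ℕ → B) (hx : IsLSP x) (β : B) (hβ : β ≠ x 0) :
    ∃ γ, gmor x β = gmor x γ ++ [β] := by
  by_cases h : ∃ i, x i = β
  · obtain ⟨i, rfl⟩ := h
    cases i with
    | zero => exact absurd rfl hβ
    | succ i => exact ⟨x i, by rw [gmor_eq x hx, gmor_eq x hx, blk_succ x i hβ]⟩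
  · refine ⟨x 0, ?_⟩
    rw [gmor_alpha x hx, gmor, dif_neg h]; rfl

theorem decomp (x : ℕ → B) (hx : IsLSP x) (k : ℕ) (hk : x k = x 0) (n : ℕ) :
    ∃ v, infPrefix (fun i => x (k + i)) (n + 1) = applyM (gmor x) v ++ blk x (k + n) := by
  induction n with
  | zero => exact ⟨[], by simp [applyM_nil, blk_alpha x k hk, infPrefix, hk]⟩
  | succ n ih =>
    obtain ⟨v, hv⟩ := ih
    have e : infPrefix (fun i => x (k + i)) (n + 1 + 1) =
        infPrefix (fun i => x (k + i)) (n + 1) ++ [x (k + (n + 1))] := by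
      rw [infPrefix_add]; simp [infPrefix]
    by_cases h : x (k + (n + 1)) = x 0
    · refine ⟨v ++ [x (k + n)], ?_⟩
      rw [e, hv, applyM_append, applyM_single, gmor_eq x hx, blk_alpha x _ h, h]
    · refine ⟨v, ?_⟩
      rw [e, hv, ← add_assoc, blk_succ x (k + n) h, List.append_assoc]

theorem decomp' (x : ℕ → B) (hx : IsLSP x) (u : List B) (hu : u.head? = some (x 0))
    (hf : IsFactorI u x) : ∃ v, u = applyM (gmor x) v := by
  obtain ⟨k, hk⟩ := hf
  cases u with
  | nil => simp at hu
  | cons b u =>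
    simp at hu
    have h0 := hk 0 (by simp)
    simp [hu] at h0
    obtain ⟨v, hv⟩ := decomp x hx k h0.symm u.length
    refine ⟨v ++ [x (k + u.length)], ?_⟩
    rw [applyM_append, applyM_single, gmor_eq x hx, ← hv]
    exact (isPrefixI_iff (b :: u) (fun i => x (k + i))).1 hk

theorem listPow_mul (u : List B) (k n : ℕ) : listPow (listPow u k) n = listPow u (n * k) := by
  induction n with
  | zero => simp [listPow]
  | succ n ih =>
    have h1 : listPow (listPow u k) (n + 1) = listPow u k ++ listPow (listPow u k) n := by
      simp [listPow, List.replicate_succ]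
    rw [h1, ih, Nat.succ_mul, add_comm]
    simp only [listPow, List.replicate_add, List.flatten_append]

theorem plsp_of (f : A → List B) (hf : Nonerasing f) (hp : PreservesLSP f) (a0 : A) (u : List B)
    (hu : ∀ a, ∃ k, 0 < k ∧ f a = listPow u k) : InPLSP f := by
  obtain ⟨k0, hk0, e0⟩ := hu a0
  refine ⟨hf, u, ?_, hu, ?_⟩
  · rintro rfl
    apply hf a0
    rw [e0]; simp [listPow]
  · intro x hx
    refine hp (om [a0] (by simp)) x (om_nodup_LSP _ _ (by simp)) ?_
    intro n
    have e := infPrefix_om [a0] (by simp) n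
    simp only [List.length_singleton, mul_one] at e
    rw [e, applyM_listPow, applyM_single, e0]
    have : listPow (listPow u k0) n = listPow u (n * k0) := listPow_mul u k0 n
    rw [this]
    exact hx _


theorem length_applyM_lt (g : B → List B) (α : B)
    (hg : ∀ β, ∃ s, g β = α :: s ∧ α ∉ s ∧ (∃ t, g β = t ++ [β]) ∧ (β ≠ α → s ≠ []))
    (v : List B) (h : (applyM g v).length ≤ v.length) : v = List.replicate v.length α := by
  have hne : Nonerasing g := by
    intro b; obtain ⟨s, hs, -⟩ := hg b; simp [hs]
  induction v with
  | nil => rfl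
  | cons b v ih =>
    rw [applyM_cons, List.length_append, List.length_cons] at h
    have h1 := length_applyM g hne v
    obtain ⟨s, hs, -, -, hs2⟩ := hg b
    rw [hs, List.length_cons] at h
    have hb : b = α := by
      by_contra hb
      have := List.length_pos_iff.2 (hs2 hb)
      omega
    have := ih (by omega)
    rw [List.length_cons, List.replicate_succ, ← this, hb]

theorem main_aux {A B : Type*} [Fintype A] [DecidableEq B] (n : ℕ) :
    ∀ (f : A → List B), Nonerasing f → PreservesLSP f → (∑ a, (f a).length) = n →
    (∃ (L : List (B → List B)) (ν : A → List B),
      (∀ g ∈ L, IsBLSP g ∧ Nonerasing g) ∧ InU ν ∧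
      (∀ a : A, f a = L.foldr (fun g v => applyM g v) (ν a))) ∨ InPLSP f := by
  induction n using Nat.strong_induction_on with
  | _ n ih =>
  intro f hf hp hn
  by_cases hd : ∃ a b, (f a).head? ≠ (f b).head?
  · obtain ⟨a, b, hab⟩ := hd
    exact Or.inl ⟨[], f, by simp, inU_of_heads f hf hp a b hab, by simp⟩
  push Not at hd
  rcases isEmpty_or_nonempty A with hA | ⟨⟨a0⟩⟩
  · exact Or.inl ⟨[], f, by simp, ⟨hf, by simp⟩, by simp⟩
  let l : List A := Finset.univ.toList
  have hl : l ≠ [] := by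
    have : a0 ∈ l := by simp [l]
    exact List.ne_nil_of_mem this
  have hX := applyM_ne_nil f hf l hl
  let x := om (applyM f l) hX
  have hx : IsLSP x := pres_om f hp l hl (om_nodup_LSP _ _ (Finset.nodup_toList _)) _ hX rfl
  have hfac : ∀ a, IsFactorI (f a) x := by
    intro a
    have : a ∈ l := by simp [l]
    obtain ⟨s, t, hst⟩ := List.append_of_mem this
    have h1 : applyM f l = applyM f s ++ (f a ++ applyM f t) := by
      rw [hst, applyM_append, applyM_cons]
    refine ⟨(applyM f s).length, ?_⟩
    intro i hi
    have h2 := om_lt _ hX ((applyM f s).length + i) (by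
      have := congrArg List.length h1
      simp only [List.length_append] at this; omega)
    have h3 : (applyM f l)[(applyM f s).length + i]? = some (f a)[i] := by
      rw [h1, List.getElem?_append_right (by omega), Nat.add_sub_cancel_left,
        List.getElem?_append_left hi, List.getElem?_eq_getElem hi]
    rw [h3] at h2
    exact Option.some.inj h2
  have hhead : ∀ a, (f a).head? = some (x 0) := by
    have h0 : x 0 = x 0 := rfl
    obtain ⟨b, t, hbt⟩ := List.exists_cons_of_ne_nil hl
    have h1 : applyM f l = f b ++ applyM f t := by rw [hbt, applyM_cons]
    have hb := List.length_pos_iff.2 (hf b)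
    have h2 := om_lt _ hX 0 (List.length_pos_iff.2 hX)
    have h3 : (applyM f l)[0]? = (f b).head? := by
      rw [h1, List.getElem?_append_left hb, List.head?_eq_getElem?]
    intro a
    rw [hd a b, ← h3, h2]
  choose f' hf' using fun a => decomp' x hx (f a) (hhead a) (hfac a)
  have hprop := blsp_props (gmor x) (x 0) (gmor_alpha x hx) (gmor_blsp x hx)
  have hgne : Nonerasing (gmor x) := by
    intro b; obtain ⟨s, hs, -⟩ := hprop b; simp [hs]
  have hne' : Nonerasing f' := by
    intro a h
    apply hf a
    rw [hf' a, h, applyM_nil]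
  have hff : f = fun a => applyM (gmor x) (f' a) := funext hf'
  have hp' : PreservesLSP f' := by
    intro w y hw hy
    obtain ⟨z, hz⟩ := exists_image (gmor x) hgne y
    refine blsp_reflect (gmor x) (x 0) hprop y z hz (hp w z hw ?_)
    intro m
    rw [hff, applyM_comp, (isPrefixI_iff _ _).1 (hy m)]
    exact hz _
  have hle : ∀ a, (f' a).length ≤ (f a).length := by
    intro a; rw [hf' a]; exact length_applyM _ hgne _
  by_cases hlt : ∃ a, (f' a).length < (f a).length
  · obtain ⟨a, ha⟩ := hlt
    have hs : (∑ a, (f' a).length) < n := by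
      rw [← hn]
      exact Finset.sum_lt_sum (fun a _ => hle a) ⟨a, Finset.mem_univ _, ha⟩
    rcases ih _ hs f' hne' hp' rfl with ⟨L, ν, hL, hν, he⟩ | ⟨-, u, -, hu, -⟩
    · left
      refine ⟨gmor x :: L, ν, ?_, hν, ?_⟩
      · intro g hg
        rcases List.mem_cons.1 hg with rfl | hg
        · exact ⟨⟨x 0, gmor_alpha x hx, gmor_blsp x hx⟩, hgne⟩
        · exact hL g hg
      · intro a
        rw [hf' a, List.foldr_cons, ← he a]
    · right
      refine plsp_of f hf hp a0 (applyM (gmor x) u) ?_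
      intro a
      obtain ⟨k, hk, e⟩ := hu a
      exact ⟨k, hk, by rw [hf' a, e, applyM_listPow]⟩
  · push Not at hlt
    right
    refine plsp_of f hf hp a0 [x 0] ?_
    intro a
    have h1 := length_applyM_lt (gmor x) (x 0) hprop (f' a) (by rw [← hf' a]; exact hlt a)
    have h2 : f' a = listPow [x 0] (f' a).length := by
      rw [listPow, List.flatten_replicate_singleton]; exact h1
    refine ⟨(f' a).length, List.length_pos_iff.2 (hne' a), ?_⟩
    rw [hf' a]
    conv_lhs => rw [h2]
    rw [applyM_listPow, applyM_single, gmor_alpha x hx]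

end LSPProof2


/-- any nonerasing morphism preserving the LSP property belongs to
`S_{R-bLSP}(B)* U(A,B) ∪ P_LSP(A,B)`. -/
theorem preserving_in_RbLSP_U_or_PLSP {A B : Type*} [Fintype A] [Fintype B]
    [DecidableEq B] (f : A → List B) (hne : Nonerasing f)
    (hpres : PreservesLSP f) :
    (∃ (L : List (B → List B)) (ν : A → List B),
      (∀ g ∈ L, ∃ D : Set B, IsRBLSPOn D g) ∧
      CompatChain L ∧
      (∀ (a : A) (y : B), y ∈ ν a → ∀ g ∈ L.getLast?, g y ≠ []) ∧
      InU ν ∧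
      (∀ a : A, f a = L.foldr (fun g v => applyM g v) (ν a))) ∨
    InPLSP f := by
  rcases main_aux _ f hne hpres rfl with ⟨L, ν, hL, hν, he⟩ | h
  · left
    refine ⟨L, ν, ?_, ?_, ?_, hν, he⟩
    · intro g hg
      exact ⟨Set.univ, fun x => ⟨fun _ => (hL g hg).2 x, fun _ => Set.mem_univ _⟩, g,
        (hL g hg).1, fun _ _ => rfl⟩
    · refine List.Pairwise.isChain (List.pairwise_iff_getElem.2 ?_)
      intro i j hi hj _ x y _
      exact (hL _ (List.getElem_mem hi)).2 y
    · intro a y _ g hg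
      exact (hL g (List.mem_of_getLast? hg)).2 y
  · exact Or.inr h
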